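/- arXiv:2411.07830 — 5 statements merged into one kernel-verified Lean document; each statement's English description precedes it below -/
import Mathlib

section
/- Let n be a positive integer, γ > 0 and λ̄ ≥ 0 real. Let q, v : ℝ → ℝ^n be continuously differentiable with q'(t) = v(t), and suppose v'(t) = Minv(t) ( u(t) − Cmat(t) v(t) − G(t) − d(t) ) for all t ≥ 0, where Minv(t), Cmat(t) are n×n real matrices and u(t), G(t), d(t), μ(t) ∈ ℝ^n depend continuously on t. Let η : ℝ^n → ℝ be twice continuously differentiable, let ε ∈ ℝ, set z(t) := 1 − ε − η(q(t)), and let β₁ : ℝ → ℝ be continuously differentiable. Define h(t) := −⟨∇η(q(t)), v(t)⟩ + γ β₁(z(t)). Let β₂ : ℝ → ℝ be a locally Lipschitz extended class-K function and δ > 0. Assume h(0) ≥ 0 and that for every t ≥ 0: ‖μ(t) − d(t)‖ ≤ λ̄ and −⟨∇η(q(t)), Minv(t)(u(t) − Cmat(t)v(t) − G(t) − μ(t))⟩ − ⟨v(t), Hess η(q(t)) v(t)⟩ − γ β₁'(z(t)) ⟨∇η(q(t)), v(t)⟩ ≥ −δ β₂(h(t)) + ‖Minv(t)ᵀ ∇η(q(t))‖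 λ̄, where Hess η(q) is the Hessian matrix of η at q. Then h(t) ≥ 0 for all t ≥ 0. -/
open Matrix RealInnerProductSpace

/-- Matrix–vector multiplication on Euclidean space. -/
noncomputable def matVecMul {n : ℕ} (M : Matrix (Fin n) (Fin n) ℝ)
    (x : EuclideanSpace ℝ (Fin n)) : EuclideanSpace ℝ (Fin n) :=
  (EuclideanSpace.equiv (Fin n) ℝ).symm (M.mulVec (EuclideanSpace.equiv (Fin n) ℝ x))

theorem matVecMul_sub {n : ℕ} (M : Matrix (Fin n) (Fin n) ℝ) (x y : EuclideanSpace ℝ (Fin n)) :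
    matVecMul M (x - y) = matVecMul M x - matVecMul M y := by
  simp [matVecMul, Matrix.mulVec_sub]

theorem inner_matVecMul_right {n : ℕ} (M : Matrix (Fin n) (Fin n) ℝ)
    (x y : EuclideanSpace ℝ (Fin n)) :
    inner ℝ x (matVecMul M y) = inner ℝ (matVecMul Mᵀ x) y := by
  simp only [matVecMul, EuclideanSpace.inner_eq_star_dotProduct, star_trivial,
    PiLp.coe_symm_continuousLinearEquiv, PiLp.coe_continuousLinearEquiv]
  rw [Matrix.mulVec_transpose, dotProduct_comm, Matrix.dotProduct_mulVec, dotProduct_comm]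

/-- A function whose derivative is positive wherever it is negative stays nonnegative. -/
theorem nonneg_of_hasDerivAt_pos_of_neg {f f' : ℝ → ℝ} {a : ℝ}
    (hf : ∀ t, a ≤ t → HasDerivAt f (f' t) t) (ha : 0 ≤ f a)
    (hpos : ∀ t, a ≤ t → f t < 0 → 0 < f' t) {t : ℝ} (ht : a ≤ t) : 0 ≤ f t := by
  refine neg_nonpos.mp (le_of_forall_pos_le_add fun c hc => ?_)
  rw [zero_add]
  refine image_le_of_deriv_right_lt_deriv_boundary (f := fun s => -f s) (f' := fun s => -f' s)
    (a := a) (b := t) (B := fun _ => c) (B' := fun _ => 0)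
    (fun s hs => (hf s hs.1).neg.continuousAt.continuousWithinAt)
    (fun s hs => (hf s hs.1).neg.hasDerivWithinAt) (by linarith)
    (fun s => hasDerivAt_const s c) (fun s hs hsc => ?_) ⟨ht, le_rfl⟩
  have := hpos s hs.1 (by linarith)
  linarith

/-- The derivative of `t ↦ ⟨∇η(q(t)), v(t)⟩` along a curve `q` with velocity `v`. -/
theorem hasDerivAt_inner_gradient {E : Type*} [NormedAddCommGroup E] [InnerProductSpace ℝ E]
    [CompleteSpace E] {η : E → ℝ} (hη : ContDiff ℝ 2 η) {q v : ℝ → E} {v' : E} {t : ℝ}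
    (hq : HasDerivAt q (v t) t) (hv : HasDerivAt v v' t) :
    HasDerivAt (fun s => inner ℝ (gradient η (q s)) (v s))
      (fderiv ℝ (fderiv ℝ η) (q t) (v t) (v t) + inner ℝ (gradient η (q t)) v') t := by
  have hd : DifferentiableAt ℝ (fderiv ℝ η) (q t) :=
    ((hη.fderiv_right (m := 1) (by norm_num)).differentiable (by norm_num)) _
  simpa [gradient] using (hd.hasFDerivAt.comp_hasDerivAt t hq).clm_apply hv

/-- Theorem 1 in trajectory form. Along the robot dynamics
`q̇ = v`, `v̇ = M⁻¹(u − C v − G − d)`, with `z(t) = 1 − ε − η(q(t))` and barrier function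
`h(t) = ż(t) + γ β₁(z(t)) = −⟨∇η(q(t)), v(t)⟩ + γ β₁(z(t))`, if `h(0) ≥ 0`, the GP
prediction error is bounded by `‖μ(t) − d(t)‖ ≤ λ̄`, and the robust CBF condition
holds for all `t ≥ 0`, then `h(t) ≥ 0` for all `t ≥ 0`. -/
theorem theorem1_trajectory_forward_invariance
    {n : ℕ} (hn : 0 < n)
    (γ lamBar ε δ : ℝ) (hγ : 0 < γ) (hlam : 0 ≤ lamBar) (hδ : 0 < δ)
    (q v : ℝ → EuclideanSpace ℝ (Fin n))
    (Minv Cmat : ℝ → Matrix (Fin n) (Fin n) ℝ)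
    (u G d μ : ℝ → EuclideanSpace ℝ (Fin n))
    (hMinv_cont : Continuous Minv) (hCmat_cont : Continuous Cmat)
    (hu_cont : Continuous u) (hG_cont : Continuous G)
    (hd_cont : Continuous d) (hμ_cont : Continuous μ)
    (hq : ∀ t : ℝ, HasDerivAt q (v t) t)
    (hv : ∀ t : ℝ, 0 ≤ t →
      HasDerivAt v (matVecMul (Minv t) (u t - matVecMul (Cmat t) (v t) - G t - d t)) t)
    (η : EuclideanSpace ℝ (Fin n) → ℝ) (hη : ContDiff ℝ 2 η)
    (β₁ : ℝ → ℝ) (hβ₁ : ContDiff ℝ 1 β₁)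
    (β₂ : ℝ → ℝ) (hβ₂_lip : LocallyLipschitz β₂) (hβ₂_cont : Continuous β₂)
    (hβ₂_mono : StrictMono β₂) (hβ₂_zero : β₂ 0 = 0)
    (z h : ℝ → ℝ)
    (hz : ∀ t : ℝ, z t = 1 - ε - η (q t))
    (hh : ∀ t : ℝ, h t = -⟪gradient η (q t), v t⟫ + γ * β₁ (z t))
    (hh0 : h 0 ≥ 0)
    (hbound : ∀ t : ℝ, 0 ≤ t → ‖μ t - d t‖ ≤ lamBar)
    (hcond : ∀ t : ℝ, 0 ≤ t →
      -⟪gradient η (q t), matVecMul (Minv t) (u t - matVecMul (Cmat t) (v t) - G t - μ t)⟫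
          - (fderiv ℝ (fderiv ℝ η) (q t)) (v t) (v t)
          - γ * deriv β₁ (z t) * ⟪gradient η (q t), v t⟫
        ≥ -δ * β₂ (h t) + ‖matVecMul (Minv t)ᵀ (gradient η (q t))‖ * lamBar) :
    ∀ t : ℝ, 0 ≤ t → h t ≥ 0 := by
  intro t ht
  have hz' : ∀ s, HasDerivAt z (-inner ℝ (gradient η (q s)) (v s)) s := fun s => by
    have hd : DifferentiableAt ℝ η (q s) := hη.differentiable (by norm_num) _
    rw [funext hz]
    simpa [gradient] using (hd.hasFDerivAt.comp_hasDerivAt s (hq s)).const_sub (1 - ε)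
  have hβ : ∀ s, HasDerivAt (fun r => β₁ (z r))
      (deriv β₁ (z s) * -inner ℝ (gradient η (q s)) (v s)) s := fun s =>
    (hβ₁.differentiable (by norm_num) (z s)).hasDerivAt.comp s (hz' s)
  refine nonneg_of_hasDerivAt_pos_of_neg (f := h) (a := 0)
    (f' := fun s =>
      -(fderiv ℝ (fderiv ℝ η) (q s) (v s) (v s) + inner ℝ (gradient η (q s))
        (matVecMul (Minv s) (u s - matVecMul (Cmat s) (v s) - G s - d s)))
      + γ * (deriv β₁ (z s) * -inner ℝ (gradient η (q s)) (v s)))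
    (fun s hs => ?_) hh0 (fun s hs hneg => ?_) ht
  · rw [funext hh]
    exact (hasDerivAt_inner_gradient hη (hq s) (hv s hs)).neg.add ((hβ s).const_mul γ)
  · have hβ₂ : δ * β₂ (h s) < 0 :=
      mul_neg_of_pos_of_neg hδ (hβ₂_zero ▸ hβ₂_mono hneg)
    have hsplit : u s - matVecMul (Cmat s) (v s) - G s - d s
        = (u s - matVecMul (Cmat s) (v s) - G s - μ s) - (d s - μ s) := by abel
    have herr : -(‖matVecMul (Minv s)ᵀ (gradient η (q s))‖ * lamBar)
        ≤ inner ℝ (gradient η (q s)) (matVecMul (Minv s) (d s - μ s)) := by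
      rw [inner_matVecMul_right]
      refine (abs_le.mp ((abs_real_inner_le_norm _ _).trans ?_)).1
      rw [norm_sub_rev]
      exact mul_le_mul_of_nonneg_left (hbound s hs) (norm_nonneg _)
    have hc := hcond s hs
    rw [hsplit, matVecMul_sub, inner_sub_right]
    linarith
end

section
/- Let α : ℝ → ℝ be a locally Lipschitz extended class-K function, and let w : ℝ → ℝ be differentiable with w(0) ≥ 0 and w'(t) ≥ −α(w(t)) for all t ≥ 0. Then w(t) ≥ 0 for all t ≥ 0. -/
/-- scalar comparison lemma / forward invariance. If `α : ℝ → ℝ` is a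
locally Lipschitz extended class-K function (continuous, strictly increasing, `α 0 = 0`),
and `w : ℝ → ℝ` is differentiable with `w 0 ≥ 0` and `w' t ≥ −α (w t)` for all `t ≥ 0`,
then `w t ≥ 0` for all `t ≥ 0`. -/
theorem cbf_comparison_lemma
    (α : ℝ → ℝ) (hα_lip : LocallyLipschitz α) (hα_cont : Continuous α)
    (hα_mono : StrictMono α) (hα_zero : α 0 = 0)
    (w : ℝ → ℝ) (hw : Differentiable ℝ w)
    (hw0 : w 0 ≥ 0)
    (hineq : ∀ t : ℝ, 0 ≤ t → deriv w t ≥ -α (w t)) :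
    ∀ t : ℝ, 0 ≤ t → w t ≥ 0 := by
  intro t ht
  refine neg_nonpos.mp (le_of_forall_pos_le_add fun ε hε => ?_)
  rw [zero_add]
  refine image_le_of_deriv_right_lt_deriv_boundary (f := fun s => -w s)
    (f' := fun s => -deriv w s) (B := fun _ => ε) (B' := fun _ => 0)
    hw.neg.continuous.continuousOn (fun s _ => (hw s).hasDerivAt.neg.hasDerivWithinAt)
    (by linarith) (fun s => hasDerivAt_const s ε) (fun s hs h => ?_)
    (Set.right_mem_Icc.mpr ht)
  have hneg : α (w s) < 0 := hα_zero ▸ hα_mono (by linarith : w s < 0)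
  linarith [hineq s hs.1]
end

section
/- Let β₁ : ℝ → ℝ be a locally Lipschitz extended class-K function and γ > 0. Let z : ℝ → ℝ be differentiable with z(0) ≥ 0 and z'(t) + γ β₁(z(t)) ≥ 0 for all t ≥ 0. Then z(t) ≥ 0 for all t ≥ 0. -/
/-- relative-degree-two reduction. If `β₁ : ℝ → ℝ` is a locally Lipschitz
extended class-K function (continuous, strictly increasing, `β₁ 0 = 0`), `γ > 0`, and
`z : ℝ → ℝ` is differentiable with `z 0 ≥ 0` and `z' t + γ β₁ (z t) ≥ 0` for all `t ≥ 0`,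
then `z t ≥ 0` for all `t ≥ 0`. -/
theorem singularity_constraint_forward_invariant
    (β₁ : ℝ → ℝ) (hβ_lip : LocallyLipschitz β₁) (hβ_cont : Continuous β₁)
    (hβ_mono : StrictMono β₁) (hβ_zero : β₁ 0 = 0)
    (γ : ℝ) (hγ : 0 < γ)
    (z : ℝ → ℝ) (hz : Differentiable ℝ z)
    (hz0 : z 0 ≥ 0)
    (hineq : ∀ t : ℝ, 0 ≤ t → deriv z t + γ * β₁ (z t) ≥ 0) :
    ∀ t : ℝ, 0 ≤ t → z t ≥ 0 := by
  intro t ht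
  suffices h : ∀ c : ℝ, 0 < c → -z t ≤ 0 + c from
    neg_nonpos.mp (le_of_forall_pos_le_add h)
  intro c hc
  rw [zero_add]
  refine image_le_of_deriv_right_lt_deriv_boundary (f := fun s => -z s)
    (f' := fun s => -deriv z s) (B := fun _ => c) (B' := fun _ => 0) (a := 0) (b := t)
    hz.continuous.neg.continuousOn
    (fun s _ => (hz s).hasDerivAt.neg.hasDerivWithinAt) (by linarith)
    (fun s => hasDerivAt_const s c) ?_ ⟨ht, le_rfl⟩
  intro s hs hzs
  have hzs_neg : z s < 0 := by linarith
  have hβ_neg : β₁ (z s) < 0 := hβ_zero ▸ hβ_mono hzs_neg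
  linarith [hineq s hs.1, mul_neg_of_pos_of_neg hγ hβ_neg]
end

section
/- Let n be a positive integer, let Γ, v, G, μ ∈ ℝ^n, let Minv, Cmat, H be real n×n matrices, let β₂ : ℝ → ℝ, and let η_q, η_{q²}, m_max, c_max, g_max, v_max, u_max, λ̄ ≥ 0, γ ≥ 0, b₁' ≥ 0, δ ≥ 0, hval ∈ ℝ be reals. Assume: ‖Γ‖ ≤ η_q; Minv is symmetric positive semidefinite with Minv ⪯ m_max I_n; ‖Cmat‖ ≤ c_max ‖v‖ (operator norm); ‖G‖ ≤ g_max; |v_i| ≤ v_max for every i; ‖H‖ ≤ η_{q²} (operator norm); and that the sufficient condition holds: n η_{q²} v_max² + √n · γ b₁' η_q v_max + η_q m_max ( √n · u_max + n c_max v_max² + g_max + ‖μ‖ + λ̄ ) ≤ δ β₂(hval). Then every u ∈ ℝ^n with |u_i| ≤ u_max for all i satisfies the robust control barrier function condition −⟨Γ, Minv (u − Cmat v − G − μ)⟩ − ⟨v, Hᵀ v⟩ − γ b₁' ⟨Γ, v⟩ ≥ −δ β₂(hval) + ‖Minvᵀ Γ‖ λ̄; in particular such a u exists (e.g., u = 0).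 -/
open Matrix RealInnerProductSpace

/-- A positive operator whose quadratic form is bounded by `c ‖x‖ ^ 2` has norm at most `c`. -/
theorem LinearMap.IsPositive.norm_apply_le_of_inner_le {E : Type*} [NormedAddCommGroup E]
    [InnerProductSpace ℝ E] {T : E →ₗ[ℝ] E} (hT : T.IsPositive) {c : ℝ} (hc : 0 ≤ c)
    (hle : ∀ x, ⟪x, T x⟫ ≤ c * ‖x‖ ^ 2) (x : E) : ‖T x‖ ≤ c * ‖x‖ := by
  have quad (t : ℝ) : 0 ≤ c * ‖x‖ ^ 2 - 2 * t * ‖T x‖ ^ 2 + t ^ 2 * (c * ‖T x‖ ^ 2) := by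
    have hpos := hT.inner_nonneg_right (x - t • T x)
    have hsymm : ⟪x, T (T x)⟫ = ‖T x‖ ^ 2 := by
      rw [← hT.isSymmetric x (T x), real_inner_self_eq_norm_sq]
    simp only [map_sub, map_smul, inner_sub_left, inner_sub_right, real_inner_smul_left,
      real_inner_smul_right, hsymm, real_inner_self_eq_norm_sq] at hpos
    nlinarith [hle x, mul_le_mul_of_nonneg_left (hle (T x)) (sq_nonneg t)]
  rcases hc.eq_or_lt with rfl | hc'
  · nlinarith [quad 1, norm_nonneg (T x)]
  · have h := mul_nonneg hc (quad c⁻¹)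
    have hrw : c * (c * ‖x‖ ^ 2 - 2 * c⁻¹ * ‖T x‖ ^ 2 + c⁻¹ ^ 2 * (c * ‖T x‖ ^ 2))
        = (c * ‖x‖) ^ 2 - ‖T x‖ ^ 2 := by
      field_simp
      ring
    rw [hrw] at h
    exact (sq_le_sq₀ (norm_nonneg _) (by positivity)).1 (by linarith)

theorem matVecMul_eq_toEuclideanCLM {n : ℕ} (M : Matrix (Fin n) (Fin n) ℝ)
    (x : EuclideanSpace ℝ (Fin n)) :
    matVecMul M x = Matrix.toEuclideanCLM (𝕜 := ℝ) M x := rfl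

theorem norm_matVecMul_le {n : ℕ} (M : Matrix (Fin n) (Fin n) ℝ)
    (x : EuclideanSpace ℝ (Fin n)) :
    ‖matVecMul M x‖ ≤ ‖Matrix.toEuclideanCLM (𝕜 := ℝ) M‖ * ‖x‖ :=
  (Matrix.toEuclideanCLM (𝕜 := ℝ) M).le_opNorm x

theorem inner_matVecMul_transpose {n : ℕ} (M : Matrix (Fin n) (Fin n) ℝ)
    (x : EuclideanSpace ℝ (Fin n)) : ⟪x, matVecMul Mᵀ x⟫ = ⟪x, matVecMul M x⟫ := by
  simp only [matVecMul_eq_toEuclideanCLM, Matrix.inner_toEuclideanCLM]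
  rw [Matrix.mulVec_transpose, dotProduct_comm, Matrix.dotProduct_mulVec]

/-- In the Loewner order, `0 ⪯ M ⪯ c • 1` bounds the operator norm of `M` by `c`. -/
theorem norm_matVecMul_le_of_posSemidef {n : ℕ} {M : Matrix (Fin n) (Fin n) ℝ} {c : ℝ}
    (hc : 0 ≤ c) (hM : M.PosSemidef)
    (hle : (c • (1 : Matrix (Fin n) (Fin n) ℝ) - M).PosSemidef)
    (x : EuclideanSpace ℝ (Fin n)) : ‖matVecMul M x‖ ≤ c * ‖x‖ := by
  refine (Matrix.isPositive_toEuclideanLin_iff.2 hM).norm_apply_le_of_inner_le hc (fun y => ?_) x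
  have h := (Matrix.isPositive_toEuclideanLin_iff.2 hle).inner_nonneg_right y
  rw [← Matrix.coe_toEuclideanCLM_eq_toEuclideanLin] at h ⊢
  simp only [map_sub, map_smul, map_one, ContinuousLinearMap.coe_coe,
    _root_.sub_apply, _root_.smul_apply, one_apply_eq_self, inner_sub_right, real_inner_smul_right,
    real_inner_self_eq_norm_sq] at h
  exact sub_nonneg.1 h

theorem EuclideanSpace.norm_le_sqrt_mul_of_abs_le {n : ℕ} {x : EuclideanSpace ℝ (Fin n)} {b : ℝ}
    (hb : 0 ≤ b) (hx : ∀ i, |x i| ≤ b) : ‖x‖ ≤ Real.sqrt n * b := by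
  rw [EuclideanSpace.norm_eq, ← Real.sqrt_sq hb, ← Real.sqrt_mul n.cast_nonneg]
  apply Real.sqrt_le_sqrt
  calc ∑ i, ‖x i‖ ^ 2 ≤ ∑ _i : Fin n, b ^ 2 :=
        Finset.sum_le_sum fun i _ => pow_le_pow_left₀ (norm_nonneg _) (hx i) 2
    _ = n * b ^ 2 := by simp

/-- Lemma 3. Under the physical bounds on the robot model, if the
sufficient condition
`n η_{q²} v_max² + √n γ b₁' η_q v_max + η_q m_max (√n u_max + n c_max v_max² + g_max + ‖μ‖ + λ̄)
  ≤ δ β₂(hval)`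
holds, then every actuator-feasible input `u` (i.e. `|uᵢ| ≤ u_max` for all `i`) satisfies the
robust CBF condition, and in particular such an input exists. -/
theorem lemma3_feasibility
    {n : ℕ} (hn : 0 < n)
    (Γ v G μ : EuclideanSpace ℝ (Fin n))
    (Minv Cmat H : Matrix (Fin n) (Fin n) ℝ)
    (β₂ : ℝ → ℝ)
    (ηq ηq2 mmax cmax gmax vmax umax lamBar γ b₁' δ : ℝ) (hval : ℝ)
    (hηq : 0 ≤ ηq) (hηq2 : 0 ≤ ηq2) (hmmax : 0 ≤ mmax) (hcmax : 0 ≤ cmax)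
    (hgmax : 0 ≤ gmax) (hvmax : 0 ≤ vmax) (humax : 0 ≤ umax) (hlam : 0 ≤ lamBar)
    (hγ : 0 ≤ γ) (hb₁' : 0 ≤ b₁') (hδ : 0 ≤ δ)
    (hΓ : ‖Γ‖ ≤ ηq)
    (hMpsd : Minv.PosSemidef)
    (hMle : (mmax • (1 : Matrix (Fin n) (Fin n) ℝ) - Minv).PosSemidef)
    (hC : ‖Matrix.toEuclideanCLM (𝕜 := ℝ) Cmat‖ ≤ cmax * ‖v‖)
    (hG : ‖G‖ ≤ gmax)
    (hv : ∀ i : Fin n, |v i| ≤ vmax)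
    (hH : ‖Matrix.toEuclideanCLM (𝕜 := ℝ) H‖ ≤ ηq2)
    (hsuff : n * ηq2 * vmax ^ 2 + Real.sqrt n * γ * b₁' * ηq * vmax
        + ηq * mmax * (Real.sqrt n * umax + n * cmax * vmax ^ 2 + gmax + ‖μ‖ + lamBar)
      ≤ δ * β₂ hval) :
    (∀ u : EuclideanSpace ℝ (Fin n), (∀ i : Fin n, |u i| ≤ umax) →
        -⟪Γ, matVecMul Minv (u - matVecMul Cmat v - G - μ)⟫
            - ⟪v, matVecMul Hᵀ v⟫ - γ * b₁' * ⟪Γ, v⟫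
          ≥ -δ * β₂ hval + ‖matVecMul Minvᵀ Γ‖ * lamBar)
      ∧ ∃ u : EuclideanSpace ℝ (Fin n), (∀ i : Fin n, |u i| ≤ umax) ∧
          -⟪Γ, matVecMul Minv (u - matVecMul Cmat v - G - μ)⟫
              - ⟪v, matVecMul Hᵀ v⟫ - γ * b₁' * ⟪Γ, v⟫
            ≥ -δ * β₂ hval + ‖matVecMul Minvᵀ Γ‖ * lamBar := by
  have feasible : ∀ u : EuclideanSpace ℝ (Fin n), (∀ i : Fin n, |u i| ≤ umax) →
      -⟪Γ, matVecMul Minv (u - matVecMul Cmat v - G - μ)⟫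
          - ⟪v, matVecMul Hᵀ v⟫ - γ * b₁' * ⟪Γ, v⟫
        ≥ -δ * β₂ hval + ‖matVecMul Minvᵀ Γ‖ * lamBar := by
    intro u hu
    have hMnorm := norm_matVecMul_le_of_posSemidef hmmax hMpsd hMle
    have hMT : Minvᵀ = Minv := by simpa using hMpsd.isHermitian.eq
    have hvn : ‖v‖ ≤ Real.sqrt n * vmax := EuclideanSpace.norm_le_sqrt_mul_of_abs_le hvmax hv
    have hun : ‖u‖ ≤ Real.sqrt n * umax := EuclideanSpace.norm_le_sqrt_mul_of_abs_le humax hu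
    have hv2 : ‖v‖ ^ 2 ≤ n * vmax ^ 2 := by
      calc ‖v‖ ^ 2 ≤ (Real.sqrt n * vmax) ^ 2 := by gcongr
        _ = n * vmax ^ 2 := by rw [mul_pow, Real.sq_sqrt n.cast_nonneg]
    have hCv : ‖matVecMul Cmat v‖ ≤ n * cmax * vmax ^ 2 := by
      calc ‖matVecMul Cmat v‖ ≤ cmax * ‖v‖ * ‖v‖ :=
            (norm_matVecMul_le Cmat v).trans (by gcongr)
        _ = cmax * ‖v‖ ^ 2 := by ring
        _ ≤ cmax * (n * vmax ^ 2) := by gcongr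
        _ = n * cmax * vmax ^ 2 := by ring
    have hw : ‖u - matVecMul Cmat v - G - μ‖
        ≤ Real.sqrt n * umax + n * cmax * vmax ^ 2 + gmax + ‖μ‖ := by
      linarith [norm_sub_le (u - matVecMul Cmat v - G) μ,
        norm_sub_le (u - matVecMul Cmat v) G, norm_sub_le u (matVecMul Cmat v)]
    have hdrift : ⟪Γ, matVecMul Minv (u - matVecMul Cmat v - G - μ)⟫
        ≤ ηq * (mmax * (Real.sqrt n * umax + n * cmax * vmax ^ 2 + gmax + ‖μ‖)) := by
      refine (real_inner_le_norm _ _).trans ?_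
      gcongr
      exact (hMnorm _).trans (by gcongr)
    have hhess : ⟪v, matVecMul Hᵀ v⟫ ≤ n * ηq2 * vmax ^ 2 := by
      rw [inner_matVecMul_transpose]
      calc ⟪v, matVecMul H v⟫ ≤ ‖v‖ * (ηq2 * ‖v‖) := by
            refine (real_inner_le_norm _ _).trans ?_
            gcongr
            exact (norm_matVecMul_le H v).trans (by gcongr)
        _ = ηq2 * ‖v‖ ^ 2 := by ring
        _ ≤ ηq2 * (n * vmax ^ 2) := by gcongr
        _ = n * ηq2 * vmax ^ 2 := by ring
    have hgrad : γ * b₁' * ⟪Γ, v⟫ ≤ γ * b₁' * (ηq * (Real.sqrt n * vmax)) := by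
      gcongr
      exact (real_inner_le_norm _ _).trans (by gcongr)
    have herror : ‖matVecMul Minvᵀ Γ‖ * lamBar ≤ mmax * ηq * lamBar := by
      rw [hMT]
      gcongr
      exact (hMnorm Γ).trans (by gcongr)
    linarith
  exact ⟨feasible, 0, fun _ => by simpa using humax, feasible 0 fun _ => by simpa using humax⟩
end

section
/- Let n be a positive integer, k > 0, λ̄ ≥ 0, v_max > 0, and set v_min = −v_max. Let β₃ : ℝ → ℝ be a locally Lipschitz extended class-K function. Let v : ℝ → ℝ^n be continuously differentiable with v'(t) = Minv(t) ( u(t) − Cmat(t) v(t) − G(t) − d(t) ) for all t ≥ 0, where Minv(t), Cmat(t) are n×n real matrices and u(t), G(t), d(t), μ(t) ∈ ℝ^n depend continuously on t. Fix i ∈ {1,…,n}, let r(t) denote the i-th row of Minv(t), and assume that for all t ≥ 0: ‖μ(t) − d(t)‖ ≤ λ̄, ⟨r(t), u(t) − Cmat(t)v(t) − G(t) − μ(t)⟩ ≤ k β₃(v_max − v_i(t)) − ‖r(t)‖ λ̄, and ⟨r(t), u(t) − Cmat(t)v(t) − G(t) − μ(t)⟩ ≥ −k β₃(v_i(t) −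 v_min) + ‖r(t)‖ λ̄. If v_min ≤ v_i(0) ≤ v_max, then v_min ≤ v_i(t) ≤ v_max for all t ≥ 0. -/
open Matrix RealInnerProductSpace

/-- The `i`-th row of a square matrix, viewed as a vector of Euclidean space. -/
noncomputable def matRow {n : ℕ} (M : Matrix (Fin n) (Fin n) ℝ) (i : Fin n) :
    EuclideanSpace ℝ (Fin n) :=
  (EuclideanSpace.equiv (Fin n) ℝ).symm (M i)

/-- A function whose derivative is negative wherever the function is positive stays nonpositive
once it starts nonpositive. -/
theorem nonpos_of_hasDerivAt_neg_of_pos {f f' : ℝ → ℝ}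
    (hf : ∀ t, 0 ≤ t → HasDerivAt f (f' t) t) (hneg : ∀ t, 0 ≤ t → 0 < f t → f' t < 0)
    (h0 : f 0 ≤ 0) {t : ℝ} (ht : 0 ≤ t) : f t ≤ 0 := by
  refine le_of_forall_pos_le_add fun ε hε => ?_
  rw [zero_add]
  exact image_le_of_deriv_right_lt_deriv_boundary (a := 0) (b := t) (B := fun _ => ε)
    (B' := fun _ => 0)
    (fun x hx => (hf x hx.1).continuousAt.continuousWithinAt)
    (fun x hx => (hf x hx.1).hasDerivWithinAt) (h0.trans hε.le)
    (fun x => hasDerivAt_const x ε) (fun x hx hfx => hneg x hx.1 (hfx ▸ hε)) ⟨ht, le_rfl⟩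

theorem matVecMul_apply_eq_inner {n : ℕ} (M : Matrix (Fin n) (Fin n) ℝ)
    (x : EuclideanSpace ℝ (Fin n)) (i : Fin n) : matVecMul M x i = ⟪matRow M i, x⟫ := by
  simp [matVecMul, matRow, PiLp.inner_apply, Matrix.mulVec, dotProduct, mul_comm]

/-- Theorem 2 in trajectory form. Along the robot dynamics
`v̇ = M⁻¹(u − C v − G − d)`, with `r(t)` the `i`-th row of `M⁻¹(t)`, the GP prediction
error bounded by `‖μ(t) − d(t)‖ ≤ λ̄`, and the robust CBF conditions for the velocity
barrier functions `b̄ᵢ = v_max − vᵢ` and `b̲ᵢ = vᵢ − v_min` holding for all `t ≥ 0`,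
if `v_min ≤ vᵢ(0) ≤ v_max` then `v_min ≤ vᵢ(t) ≤ v_max` for all `t ≥ 0`. -/
theorem theorem2_velocity_forward_invariance
    {n : ℕ} (hn : 0 < n)
    (k lamBar vmax vmin : ℝ) (hk : 0 < k) (hlam : 0 ≤ lamBar) (hvmax : 0 < vmax)
    (hvmin : vmin = -vmax)
    (β₃ : ℝ → ℝ) (hβ₃_lip : LocallyLipschitz β₃) (hβ₃_cont : Continuous β₃)
    (hβ₃_mono : StrictMono β₃) (hβ₃_zero : β₃ 0 = 0)
    (v : ℝ → EuclideanSpace ℝ (Fin n))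
    (Minv Cmat : ℝ → Matrix (Fin n) (Fin n) ℝ)
    (u G d μ : ℝ → EuclideanSpace ℝ (Fin n))
    (hMinv_cont : Continuous Minv) (hCmat_cont : Continuous Cmat)
    (hu_cont : Continuous u) (hG_cont : Continuous G)
    (hd_cont : Continuous d) (hμ_cont : Continuous μ)
    (hv : ∀ t : ℝ, 0 ≤ t →
      HasDerivAt v (matVecMul (Minv t) (u t - matVecMul (Cmat t) (v t) - G t - d t)) t)
    (i : Fin n)
    (hbound : ∀ t : ℝ, 0 ≤ t → ‖μ t - d t‖ ≤ lamBar)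
    (hupper : ∀ t : ℝ, 0 ≤ t →
      ⟪matRow (Minv t) i, u t - matVecMul (Cmat t) (v t) - G t - μ t⟫
        ≤ k * β₃ (vmax - v t i) - ‖matRow (Minv t) i‖ * lamBar)
    (hlower : ∀ t : ℝ, 0 ≤ t →
      ⟪matRow (Minv t) i, u t - matVecMul (Cmat t) (v t) - G t - μ t⟫
        ≥ -(k * β₃ (v t i - vmin)) + ‖matRow (Minv t) i‖ * lamBar)
    (h0 : vmin ≤ v 0 i ∧ v 0 i ≤ vmax) :
    ∀ t : ℝ, 0 ≤ t → vmin ≤ v t i ∧ v t i ≤ vmax := by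
  have hderiv : ∀ t : ℝ, 0 ≤ t → HasDerivAt (fun s => v s i)
      ⟪matRow (Minv t) i, u t - matVecMul (Cmat t) (v t) - G t - d t⟫ t := fun t ht => by
    rw [← matVecMul_apply_eq_inner]
    exact (EuclideanSpace.proj (𝕜 := ℝ) i).hasFDerivAt.comp_hasDerivAt t (hv t ht)
  have hsplit : ∀ t : ℝ, ⟪matRow (Minv t) i, u t - matVecMul (Cmat t) (v t) - G t - d t⟫ =
      ⟪matRow (Minv t) i, u t - matVecMul (Cmat t) (v t) - G t - μ t⟫ +
        ⟪matRow (Minv t) i, μ t - d t⟫ := fun t => by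
    rw [← inner_add_right, sub_add_sub_cancel]
  have herr : ∀ t : ℝ, 0 ≤ t →
      |⟪matRow (Minv t) i, μ t - d t⟫| ≤ ‖matRow (Minv t) i‖ * lamBar := fun t ht =>
    (abs_real_inner_le_norm _ _).trans
      (mul_le_mul_of_nonneg_left (hbound t ht) (norm_nonneg _))
  have hβ_neg : ∀ x < 0, k * β₃ x < 0 := fun x hx =>
    mul_neg_of_pos_of_neg hk (hβ₃_zero ▸ hβ₃_mono hx)
  refine fun t ht => ⟨?_, ?_⟩
  · refine sub_nonpos.mp (nonpos_of_hasDerivAt_neg_of_pos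
      (fun s hs => (hderiv s hs).const_sub vmin) (fun s hs hpos => ?_) (sub_nonpos.mpr h0.1) ht)
    have := hβ_neg (v s i - vmin) (by linarith)
    linarith [hlower s hs, neg_abs_le ⟪matRow (Minv s) i, μ s - d s⟫, herr s hs, hsplit s]
  · refine sub_nonpos.mp (nonpos_of_hasDerivAt_neg_of_pos
      (fun s hs => (hderiv s hs).sub_const vmax) (fun s hs hpos => ?_) (sub_nonpos.mpr h0.2) ht)
    have := hβ_neg (vmax - v s i) (by linarith)
    linarith [hupper s hs, le_abs_self ⟪matRow (Minv s) i, μ s - d s⟫, herr s hs, hsplit s]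
end
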